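/- For every n ≥ 1, there is a bijection between the set of Schröder paths of semilength n that have no diagonal step lying on the diagonal and in which every diagonal step is immediately followed by a horizontal step except if it is the last step, and the set huMP(n) of (h,u)-colored Motzkin paths of length n−1. -/

import Mathlib

/-! Schröder paths -/

inductive SStep : Type
  | H | V | D
deriving DecidableEq

def SStep.dx : SStep → ℕ
  | .H => 1 | .V => 0 | .D => 1

def SStep.dy : SStep → ℕ
  | .H => 0 | .V => 1 | .D => 1

def pathX (p : List SStep) : ℕ := (p.map SStep.dx).sum
def pathY (p : List SStep) : ℕ := (p.map SStep.dy).sum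

/-- A Schröder path of semilength `n`: from (0,0) to (n,n), steps H,V,D,
never rising above the diagonal. -/
def IsSchroder (n : ℕ) (p : List SStep) : Prop :=
  pathX p = n ∧ pathY p = n ∧ ∀ q : List SStep, q <+: p → pathY q ≤ pathX q

/-- No diagonal step starts on the diagonal. -/
def DiagFree (p : List SStep) : Prop :=
  ∀ q r : List SStep, p = q ++ SStep.D :: r → pathX q ≠ pathY q

/-- Every diagonal step is immediately followed by a horizontal step,
except if it is the last step. -/
def DFollowedByH (p : List SStep) : Prop :=
  ∀ q r : List SStep, p = q ++ SStep.D :: r → r = [] ∨ ∃ r' : List SStep, r = SStep.H :: r'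

def SP (n m : ℕ) : Type := {p : List SStep // IsSchroder n p ∧ p.count SStep.D + m = n}
def SPplus (n m : ℕ) : Type :=
  {p : List SStep // IsSchroder n p ∧ p.count SStep.D + m = n ∧ DiagFree p}
def SPzero (n m : ℕ) : Type :=
  {p : List SStep // IsSchroder n p ∧ p.count SStep.D + m = n ∧ ¬ DiagFree p}
def RP (n m : ℕ) : Type :=
  {p : List SStep // IsSchroder n p ∧ p.count SStep.D + m = n ∧ DFollowedByH p}

/-! Rooted planar trees -/

inductive PTree : Type
  | node : List PTree → PTree

namespace PTree

def leaves : PTree → ℕ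
  | node [] => 1
  | node (c :: cs) => ((c :: cs).attach.map fun x => leaves x.1).sum
decreasing_by
  have := List.sizeOf_lt_of_mem x.2
  simp only [PTree.node.sizeOf_spec, List.cons.sizeOf_spec] at this ⊢
  omega

def internal : PTree → ℕ
  | node [] => 0
  | node (c :: cs) => 1 + ((c :: cs).attach.map fun x => internal x.1).sum
decreasing_by
  have := List.sizeOf_lt_of_mem x.2
  simp only [PTree.node.sizeOf_spec, List.cons.sizeOf_spec] at this ⊢
  omega

def Good : PTree → Prop
  | node cs => cs.length ≠ 1 ∧ ∀ c ∈ cs.attach, Good c.1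
decreasing_by
  have := List.sizeOf_lt_of_mem c.2
  simp only [PTree.node.sizeOf_spec] at this ⊢
  omega

end PTree

def PT (n m : ℕ) : Type :=
  {t : PTree // t.Good ∧ t.leaves = n + 1 ∧ t.internal = m}

def PTn (n : ℕ) : Type := {t : PTree // t.Good ∧ t.leaves = n + 1}

/-! Motzkin paths -/

inductive MStep : Type
  | U | H | D
deriving DecidableEq

def MStep.dh : MStep → ℤ
  | .U => 1 | .H => 0 | .D => -1

def mHeight (p : List MStep) : ℤ := (p.map MStep.dh).sum

def IsMotzkin (k : ℕ) (p : List MStep) : Prop :=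
  p.length = k ∧ mHeight p = 0 ∧ ∀ q : List MStep, q <+: p → 0 ≤ mHeight q

def HFollowedByU (p : List MStep) : Prop :=
  ∀ q r : List MStep, p = q ++ MStep.H :: r → r = [] ∨ ∃ r' : List MStep, r = MStep.U :: r'

def MP (k : ℕ) : Type := {p : List MStep // IsMotzkin k p}
def RMP (k : ℕ) : Type := {p : List MStep // IsMotzkin k p ∧ HFollowedByU p}

/-- Motzkin steps with two possible colors on up and horizontal steps. -/
inductive CMStep : Type
  | U : Bool → CMStep
  | H : Bool → CMStep
  | D : CMStep
deriving DecidableEq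

def CMStep.forget : CMStep → MStep
  | .U _ => .U | .H _ => .H | .D => .D

/-- (h,u)-colored Motzkin paths of length n-1. -/
def huMP (n : ℕ) : Type := {p : List CMStep // IsMotzkin (n - 1) (p.map CMStep.forget)}


/-- Schröder paths of semilength n with no diagonal step on the diagonal, in which
every diagonal step is immediately followed by a horizontal step except the last. -/
def RPplusAll (n : ℕ) : Type :=
  {p : List SStep // IsSchroder n p ∧ DiagFree p ∧ DFollowedByH p}


instance : Fintype SStep := ⟨{.H, .V, .D}, fun x => by cases x <;> simp⟩

instance : Fintype CMStep :=
  ⟨{.U false, .U true, .H false, .H true, .D}, fun x => by rcases x with (_ | _) | (_ | _) | _ <;> simp⟩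

theorem SStep.sum_eq {M : Type*} [AddCommMonoid M] (f : SStep → M) :
    ∑ x, f x = f .H + (f .V + f .D) := by
  change ∑ x ∈ {SStep.H, SStep.V, SStep.D}, f x = _
  rw [Finset.sum_insert (by simp), Finset.sum_insert (by simp), Finset.sum_singleton]

theorem CMStep.sum_eq {M : Type*} [AddCommMonoid M] (f : CMStep → M) :
    ∑ x, f x = f (.U false) + (f (.U true) + (f (.H false) + (f (.H true) + f .D))) := by
  change ∑ x ∈ {CMStep.U false, CMStep.U true, CMStep.H false, CMStep.H true, CMStep.D}, f x = _
  rw [Finset.sum_insert (by simp), Finset.sum_insert (by simp), Finset.sum_insert (by simp),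
    Finset.sum_insert (by simp), Finset.sum_singleton]

/-- A set of nonempty words is counted by sorting the words by their first letter. -/
theorem encard_eq_sum_cons {α : Type*} [Fintype α] (S : Set (List α)) (h : [] ∉ S) :
    S.encard = ∑ x, {w | x :: w ∈ S}.encard := by
  have hS : S = ⋃ x, List.cons x '' {w | x :: w ∈ S} := by
    ext w
    cases w <;> simp [h]
  conv_lhs => rw [hS]
  rw [Set.encard_iUnion_of_finite, finsum_eq_sum_of_fintype]
  · exact Finset.sum_congr rfl fun x _ => List.cons_injective.encard_image _
  · intro x y hxy
    rw [Function.onFun, Set.disjoint_left]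
    rintro _ ⟨u, -, rfl⟩ ⟨v, -, h⟩
    exact hxy (List.cons.inj h).1.symm

theorem forall_prefix_cons {α : Type*} (x : α) (w : List α) (P : List α → Prop) :
    (∀ q, q <+: x :: w → P q) ↔ P [] ∧ ∀ q, q <+: w → P (x :: q) := by
  simp only [List.prefix_cons_iff]
  grind

theorem forall_eq_append_cons {α : Type*} (x a : α) (w : List α) (P : List α → List α → Prop) :
    (∀ q r, x :: w = q ++ a :: r → P q r) ↔
      (x = a → P [] w) ∧ ∀ q r, w = q ++ a :: r → P (x :: q) r := by
  constructor
  · intro h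
    exact ⟨fun hx => h [] w (by simp [hx]), fun q r hw => h (x :: q) r (by simp [hw])⟩
  · rintro ⟨h1, h2⟩ (_ | ⟨y, q⟩) r hw
    · obtain ⟨rfl, rfl⟩ := List.cons.inj hw
      exact h1 rfl
    · obtain ⟨rfl, rfl⟩ := List.cons.inj hw
      exact h2 q r rfl

/-- Final pieces of colored Motzkin paths: `k` steps, starting at height `h`, ending at height
`0`. -/
def motzkinSuffix (k h : ℕ) : Set (List CMStep) :=
  {w | w.length = k ∧ (h : ℤ) + mHeight (w.map CMStep.forget) = 0 ∧
    ∀ q, q <+: w.map CMStep.forget → 0 ≤ (h : ℤ) + mHeight q}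

/-- The number of words in `motzkinSuffix k h`. -/
def motzkinCount : ℕ → ℕ → ℕ
  | 0, h => if h = 0 then 1 else 0
  | k + 1, 0 => 2 * motzkinCount k 1 + 2 * motzkinCount k 0
  | k + 1, h + 1 => 2 * motzkinCount k (h + 2) + 2 * motzkinCount k (h + 1) + motzkinCount k h

theorem up_cons_mem_motzkinSuffix (k h : ℕ) (c : Bool) (w : List CMStep) :
    .U c :: w ∈ motzkinSuffix (k + 1) h ↔ w ∈ motzkinSuffix k (h + 1) := by
  simp [motzkinSuffix, forall_prefix_cons, mHeight, CMStep.forget, MStep.dh, add_assoc]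

theorem horizontal_cons_mem_motzkinSuffix (k h : ℕ) (c : Bool) (w : List CMStep) :
    .H c :: w ∈ motzkinSuffix (k + 1) h ↔ w ∈ motzkinSuffix k h := by
  simp [motzkinSuffix, forall_prefix_cons, mHeight, CMStep.forget, MStep.dh]

theorem down_cons_mem_motzkinSuffix (k h : ℕ) (w : List CMStep) :
    .D :: w ∈ motzkinSuffix (k + 1) (h + 1) ↔ w ∈ motzkinSuffix k h := by
  simp only [motzkinSuffix, Set.mem_ofPred_eq, List.map_cons, forall_prefix_cons]
  simp [mHeight, CMStep.forget, MStep.dh, add_assoc]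
  intros
  positivity

theorem down_cons_notMem_motzkinSuffix_zero (k : ℕ) (w : List CMStep) :
    .D :: w ∉ motzkinSuffix k 0 := by
  rintro ⟨-, -, h⟩
  simpa [mHeight, CMStep.forget, MStep.dh] using h [.D] (by simp [CMStep.forget])

theorem encard_motzkinSuffix (k h : ℕ) : (motzkinSuffix k h).encard = motzkinCount k h := by
  induction k generalizing h with
  | zero =>
    rcases eq_or_ne h 0 with rfl | hh
    · have : motzkinSuffix 0 0 = {[]} := by
        ext w
        simp only [motzkinSuffix, Set.mem_ofPred_eq, List.length_eq_zero_iff,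
          Set.mem_singleton_iff]
        constructor
        · exact fun h => h.1
        · rintro rfl
          simp [mHeight]
      simp [this, motzkinCount]
    · have : motzkinSuffix 0 h = ∅ := by
        ext w
        simp only [motzkinSuffix, Set.mem_ofPred_eq, List.length_eq_zero_iff,
          Set.mem_empty_iff_false, iff_false]
        rintro ⟨rfl, h1, -⟩
        simp [mHeight, hh] at h1
      simp [this, motzkinCount, hh]
  | succ k ih =>
    rw [encard_eq_sum_cons _ (fun h => by simpa using h.1), CMStep.sum_eq]
    simp only [up_cons_mem_motzkinSuffix, horizontal_cons_mem_motzkinSuffix, Set.ofPred_mem_eq, ih]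
    cases h with
    | zero =>
      simp only [down_cons_notMem_motzkinSuffix_zero, Set.ofPred_false, Set.encard_empty,
        motzkinCount]
      push_cast
      ring
    | succ h =>
      simp only [down_cons_mem_motzkinSuffix, Set.ofPred_mem_eq, ih, motzkinCount]
      push_cast
      ring

/-- Final pieces of the restricted Schröder paths: starting `h` below the diagonal (measured
horizontally), climbing `b` rows and ending on the diagonal. -/
def schroderSuffix (b h : ℕ) : Set (List SStep) :=
  {w | pathY w = b ∧ h + pathX w = pathY w ∧ (∀ q, q <+: w → pathY q ≤ h + pathX q) ∧
    (∀ q r, w = q ++ SStep.D :: r → h + pathX q ≠ pathY q) ∧ DFollowedByH w}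

/-- The number of words in `schroderSuffix b h`. -/
def schroderCount : ℕ → ℕ → ℕ
  | 0, h => if h = 0 then 1 else 0
  | b + 1, h => ∑ i ∈ Finset.Ico h (b + 2),
      if i = 0 then 0 else schroderCount b (i - 1) + schroderCount b (i + 1)

theorem schroderCount_eq_zero {b h : ℕ} (hb : b < h) : schroderCount b h = 0 := by
  cases b with
  | zero => simp [schroderCount]; omega
  | succ b => rw [schroderCount, Finset.Ico_eq_empty (by omega), Finset.sum_empty]

theorem schroderCount_succ_zero (b : ℕ) : schroderCount (b + 1) 0 = schroderCount (b + 1) 1 := by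
  rw [schroderCount, schroderCount, Finset.sum_eq_sum_Ico_succ_bot (by omega)]
  simp

theorem schroderCount_succ_succ {b h : ℕ} (hb : h ≤ b) :
    schroderCount (b + 1) (h + 1) =
      schroderCount (b + 1) (h + 2) + (schroderCount b h + schroderCount b (h + 2)) := by
  rw [schroderCount, schroderCount, Finset.sum_eq_sum_Ico_succ_bot (by omega), add_comm]
  simp

theorem schroderSuffix_eq_empty {b h : ℕ} (hb : b < h) : schroderSuffix b h = ∅ := by
  ext w
  simp only [schroderSuffix, Set.mem_ofPred_eq, Set.mem_empty_iff_false, iff_false]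
  omega

theorem nil_mem_schroderSuffix (b h : ℕ) : [] ∈ schroderSuffix b h ↔ b = 0 ∧ h = 0 := by
  simp [schroderSuffix, DFollowedByH, pathX, pathY, eq_comm]

theorem horizontal_cons_mem_schroderSuffix (b h : ℕ) (w : List SStep) :
    .H :: w ∈ schroderSuffix b h ↔ w ∈ schroderSuffix b (h + 1) := by
  simp [schroderSuffix, DFollowedByH, forall_prefix_cons, forall_eq_append_cons, pathX, pathY,
    SStep.dx, SStep.dy, add_assoc]

theorem vertical_cons_mem_schroderSuffix (b h : ℕ) (w : List SStep) :
    .V :: w ∈ schroderSuffix (b + 1) (h + 1) ↔ w ∈ schroderSuffix b h := by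
  have e (x y : ℕ) : h + 1 + x = y + 1 ↔ h + x = y := by omega
  have e' (x y : ℕ) : y < h + 1 + x ↔ y ≤ h + x := by omega
  simp [schroderSuffix, DFollowedByH, forall_prefix_cons, forall_eq_append_cons, pathX, pathY,
    SStep.dx, SStep.dy, e, e', add_comm 1 _]

theorem diagonal_cons_mem_schroderSuffix (b h : ℕ) (w : List SStep) :
    .D :: w ∈ schroderSuffix (b + 1) (h + 1) ↔
      w ∈ List.cons SStep.H '' schroderSuffix b (h + 2) := by
  have key : .D :: w ∈ schroderSuffix (b + 1) (h + 1) ↔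
      w ∈ schroderSuffix b (h + 1) ∧ (w = [] ∨ ∃ r, w = .H :: r) := by
    have e (x y : ℕ) : h + 1 + (1 + x) = 1 + y ↔ h + 1 + x = y := by omega
    have eb (y : ℕ) : 1 + y = b + 1 ↔ y = b := by omega
    have e' (x y : ℕ) : 1 + y ≤ h + 1 + (1 + x) ↔ y ≤ h + 1 + x := by omega
    simp [schroderSuffix, DFollowedByH, forall_prefix_cons, forall_eq_append_cons, pathX, pathY,
      SStep.dx, SStep.dy, e, e', eb]
    tauto
  rw [key]
  constructor
  · rintro ⟨h1, rfl | ⟨r, rfl⟩⟩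
    · simp [nil_mem_schroderSuffix] at h1
    · exact ⟨r, (horizontal_cons_mem_schroderSuffix ..).1 h1, rfl⟩
  · rintro ⟨r, h1, rfl⟩
    exact ⟨(horizontal_cons_mem_schroderSuffix ..).2 h1, .inr ⟨r, rfl⟩⟩

theorem vertical_cons_notMem_schroderSuffix_zero (b : ℕ) (w : List SStep) :
    .V :: w ∉ schroderSuffix b 0 := by
  rintro ⟨-, -, h, -⟩
  simpa [pathX, pathY, SStep.dx, SStep.dy] using h [.V] (by simp)

theorem diagonal_cons_notMem_schroderSuffix_zero (b : ℕ) (w : List SStep) :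
    .D :: w ∉ schroderSuffix b 0 := by
  rintro ⟨-, -, -, h, -⟩
  simpa [pathX, pathY] using h [] w rfl

theorem encard_schroderSuffix (b h : ℕ) :
    (schroderSuffix b h).encard = schroderCount b h := by
  induction b generalizing h with
  | zero =>
    rcases eq_or_ne h 0 with rfl | hh
    · have : schroderSuffix 0 0 = {[]} := by
        ext w
        rw [Set.mem_singleton_iff]
        constructor
        · intro hw
          cases w with
          | nil => rfl
          | cons x w =>
            cases x with
            | H => simp [horizontal_cons_mem_schroderSuffix, schroderSuffix_eq_empty] at hw
            | V => exact (vertical_cons_notMem_schroderSuffix_zero _ _ hw).elim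
            | D => exact (diagonal_cons_notMem_schroderSuffix_zero _ _ hw).elim
        · rintro rfl
          simp [nil_mem_schroderSuffix]
      simp [this, schroderCount]
    · rw [schroderSuffix_eq_empty (by omega), schroderCount_eq_zero (by omega)]
      simp
  | succ b ih =>
    obtain ⟨d, hd⟩ : ∃ d, b + 1 < h + d := ⟨b + 2, by omega⟩
    induction d generalizing h with
    | zero =>
      rw [schroderSuffix_eq_empty (by omega), schroderCount_eq_zero (by omega)]
      simp
    | succ d ihd =>
      rcases lt_or_ge (b + 1) h with hb | hb
      · rw [schroderSuffix_eq_empty hb, schroderCount_eq_zero hb]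
        simp
      rw [encard_eq_sum_cons _ (by simp [nil_mem_schroderSuffix]), SStep.sum_eq]
      simp only [horizontal_cons_mem_schroderSuffix, Set.ofPred_mem_eq]
      rw [ihd (h + 1) (by omega)]
      cases h with
      | zero =>
        simp [vertical_cons_notMem_schroderSuffix_zero, diagonal_cons_notMem_schroderSuffix_zero,
          schroderCount_succ_zero]
      | succ h =>
        simp only [vertical_cons_mem_schroderSuffix, diagonal_cons_mem_schroderSuffix,
          Set.ofPred_mem_eq, List.cons_injective.encard_image, ih]
        rw [schroderCount_succ_succ (h := h) (by omega)]
        push_cast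
        rfl

theorem sum_range_choose_mul_sum_Ico (n j : ℕ) (g : ℕ → ℕ) :
    ∑ h ∈ Finset.range n, h.choose j * ∑ i ∈ Finset.Ico h n, g i =
      ∑ i ∈ Finset.range n, (i + 1).choose (j + 1) * g i := by
  have hc (i : ℕ) : (i + 1).choose (j + 1) = ∑ h ∈ Finset.range (i + 1), h.choose j := by
    induction i with
    | zero => simp [Nat.choose_succ_succ]
    | succ i ih => rw [Finset.sum_range_succ, ← ih, Nat.choose_succ_succ, add_comm]
  simp only [hc, Finset.mul_sum, Finset.sum_mul, Finset.range_eq_Ico]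
  exact Finset.sum_Ico_Ico_comm 0 n _

/-- Choosing `j` of the levels below the starting height of a Schröder suffix whose preceding step
climbs a row amounts to a Motzkin suffix that starts at height `j`. -/
theorem motzkinCount_eq_sum (k j : ℕ) :
    motzkinCount k j = ∑ h ∈ Finset.range (k + 1),
      h.choose j * (schroderCount k h + schroderCount k (h + 2)) := by
  induction k generalizing j with
  | zero => cases j <;> simp [motzkinCount, schroderCount]
  | succ k ih =>
    set u : ℕ → ℕ := fun i => schroderCount k i + schroderCount k (i + 2) with hu
    have h1 : ∑ h ∈ Finset.range (k + 2), h.choose j * schroderCount (k + 1) h =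
        ∑ i ∈ Finset.range (k + 1), (i + 2).choose (j + 1) * u i := by
      simp only [schroderCount]
      rw [sum_range_choose_mul_sum_Ico, Finset.sum_range_succ']
      simp [hu, add_assoc]
    have h2 : ∑ h ∈ Finset.range (k + 2), h.choose j * schroderCount (k + 1) (h + 2) =
        ∑ i ∈ Finset.range (k + 1), i.choose (j + 1) * u i := by
      have e (h : ℕ) : schroderCount (k + 1) (h + 2) = ∑ i ∈ Finset.Ico h k, u (i + 1) := by
        rw [schroderCount, ← Finset.sum_Ico_add' _ h k 2]
        simp [hu, add_assoc]
      simp only [e]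
      rw [Finset.sum_range_succ, Finset.sum_range_succ, sum_range_choose_mul_sum_Ico,
        Finset.sum_range_succ']
      simp
    simp only [mul_add, Finset.sum_add_distrib]
    rw [h1, h2, ← Finset.sum_add_distrib]
    cases j with
    | zero =>
      rw [motzkinCount, ih, ih, Finset.mul_sum, Finset.mul_sum, ← Finset.sum_add_distrib]
      refine Finset.sum_congr rfl fun i _ => ?_
      simp only [hu, Nat.choose_succ_succ, zero_add, Nat.choose_zero_right,
        Nat.choose_one_right]
      ring
    | succ j =>
      rw [motzkinCount, ih, ih, ih, Finset.mul_sum, Finset.mul_sum, ← Finset.sum_add_distrib,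
        ← Finset.sum_add_distrib]
      refine Finset.sum_congr rfl fun i _ => ?_
      simp only [hu, Nat.choose_succ_succ]
      ring

theorem schroderCount_succ_eq_motzkinCount (k : ℕ) :
    schroderCount (k + 1) 0 = motzkinCount k 0 := by
  rw [motzkinCount_eq_sum, schroderCount, ← Finset.range_eq_Ico, Finset.sum_range_succ']
  simp [add_assoc]

theorem nonempty_equiv_of_encard_eq {α β : Type*} {P : α → Prop} {Q : β → Prop} {n : ℕ}
    (hP : {x | P x}.encard = n) (hQ : {x | Q x}.encard = n) :
    Nonempty ({x // P x} ≃ {x // Q x}) := by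
  have : Finite {x // P x} := (Set.finite_of_encard_eq_coe hP).to_subtype
  have : Finite {x // Q x} := (Set.finite_of_encard_eq_coe hQ).to_subtype
  have cP : Nat.card {x // P x} = n := congrArg ENat.toNat hP
  have cQ : Nat.card {x // Q x} = n := congrArg ENat.toNat hQ
  exact Finite.card_eq.1 (cP.trans cQ.symm)

/-- RP⁺(n) ≃ huMP(n), the (h,u)-colored Motzkin paths of length n−1. -/
theorem statement7 (n : ℕ) (hn : 1 ≤ n) : Nonempty (RPplusAll n ≃ huMP n) := by
  obtain ⟨k, rfl⟩ := Nat.exists_eq_add_of_le' hn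
  have hS : {p | IsSchroder (k + 1) p ∧ DiagFree p ∧ DFollowedByH p} =
      schroderSuffix (k + 1) 0 := by
    ext p
    simp only [IsSchroder, DiagFree, schroderSuffix, Set.mem_ofPred_eq, zero_add]
    grind
  have hM : {p : List CMStep | IsMotzkin (k + 1 - 1) (p.map CMStep.forget)} =
      motzkinSuffix k 0 := by
    ext p
    simp [IsMotzkin, motzkinSuffix]
  have h1 := encard_schroderSuffix (k + 1) 0
  have h2 := encard_motzkinSuffix k 0
  rw [schroderCount_succ_eq_motzkinCount, ← hS] at h1
  rw [← hM] at h2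
  exact nonempty_equiv_of_encard_eq h1 h2
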